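/- arXiv:1904.06311 — 2 statements merged into one kernel-verified Lean document; each statement's English description precedes it below -/
import Mathlib

section
/- Let D ≥ 1 and let κ be a Generalized Laplace kernel in dimension D, i.e. κ(θ,θ') = exp(−λ‖θ−θ'‖_p^p) with λ > 0 and 0 < p ≤ 1. Then every finite Cartesian grid G = Π_{d=1}^D S_d ⊆ ℝ^D is axis admissible with respect to κ. -/
/-- `φ` is a completely monotone function (CMF) on `[0,∞)`: infinitely differentiable
on `(0,∞)`, right-continuous at `0`, with `(-1)^n φ^(n)(x) ≥ 0` for all `x > 0`, `n ∈ ℕ`. -/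
def IsCMF (φ : ℝ → ℝ) : Prop :=
  ContDiffOn ℝ (⊤ : ℕ∞) φ (Set.Ioi 0) ∧
  ContinuousWithinAt φ (Set.Ici 0) 0 ∧
  ∀ (n : ℕ) (x : ℝ), 0 < x → 0 ≤ (-1 : ℝ) ^ n * iteratedDeriv n φ x

/-- `‖x‖_p^p = Σ_d |x[d]|^p` on `ℝ^D`. -/
noncomputable def pPowSum {D : ℕ} (p : ℝ) (x : Fin D → ℝ) : ℝ := ∑ d, |x d| ^ p

/-- The smallest Cartesian grid `⊠(S)` containing the finite family
`θs : Fin k → ℝ^D`, as a `Finset` of `ℝ^D`. -/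
noncomputable def SetAug {D k : ℕ} (θs : Fin k → (Fin D → ℝ)) :
    Finset (Fin D → ℝ) :=
  Fintype.piFinset fun d => Finset.image (fun ℓ => θs ℓ d) Finset.univ

/-- Axis admissibility of the Cartesian grid `Π_d S_d` with respect to the kernel
`κ`: for every axis `d`, every point `θ` with `θ[d] = 0`, and all coefficients
indexed by the grid points, if `f_d(t) = |Σ_{θ' ∈ grid} c(θ') κ(θ + t e_d, θ')|` is
not identically zero then `f_d` attains its maximum and every global maximizer of
`f_d` lies in `S_d`. -/
def AxisAdmissible {D : ℕ} (Sd : Fin D → Finset ℝ)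
    (κ : (Fin D → ℝ) → (Fin D → ℝ) → ℝ) : Prop :=
  ∀ (d : Fin D) (θ : Fin D → ℝ), θ d = 0 →
    ∀ c : (Fin D → ℝ) → ℝ,
      (¬ ∀ t : ℝ,
        |∑ θ' ∈ Fintype.piFinset Sd, c θ' * κ (θ + t • (Pi.single d 1 : Fin D → ℝ)) θ'| = 0) →
      (∃ t : ℝ, ∀ s : ℝ,
        |∑ θ' ∈ Fintype.piFinset Sd, c θ' * κ (θ + s • (Pi.single d 1 : Fin D → ℝ)) θ'| ≤
          |∑ θ' ∈ Fintype.piFinset Sd, c θ' * κ (θ + t • (Pi.single d 1 : Fin D → ℝ)) θ'|) ∧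
      (∀ t : ℝ, (∀ s : ℝ,
        |∑ θ' ∈ Fintype.piFinset Sd, c θ' * κ (θ + s • (Pi.single d 1 : Fin D → ℝ)) θ'| ≤
          |∑ θ' ∈ Fintype.piFinset Sd, c θ' * κ (θ + t • (Pi.single d 1 : Fin D → ℝ)) θ'|) →
        t ∈ Sd d)


open Filter Topology

theorem ax_spectral {E : Type*} [NormedAddCommGroup E] [InnerProductSpace ℝ E]
    [FiniteDimensional ℝ E] (T : E →ₗ[ℝ] E) (hT : T.IsSymmetric)
    (hpos : ∀ x : E, x ≠ 0 → 0 < inner ℝ x (T x)) (b : E) (hb : b ≠ 0) :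
    ∃ (n : ℕ) (y : Fin n → E) (v k : Fin n → ℝ) (d N : ℝ), 0 < N ∧
      (∀ i, inner ℝ (y i) b = 0) ∧ (∀ i, 0 < v i) ∧
      (∀ i, T (y i) = v i • y i + k i • b) ∧
      T b = d • b + ∑ i, (N * k i) • y i ∧
      0 < d - N * ∑ i, (k i) ^ 2 / v i := by
  classical
  set K : Submodule ℝ E := (ℝ ∙ b)ᗮ with hK
  let P : E →L[ℝ] K := K.orthogonalProjectionOnto
  let T' : K →ₗ[ℝ] K := (P : E →ₗ[ℝ] K) ∘ₗ T ∘ₗ K.subtype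
  have hT' : T'.IsSymmetric := by
    intro x z
    have h1 : inner ℝ (T' x) z = inner ℝ (T (x : E)) (z : E) := by
      simp only [T', P, LinearMap.comp_apply, Submodule.subtype_apply,
        ContinuousLinearMap.coe_coe]
      rw [Submodule.coe_inner]
      exact Submodule.inner_orthogonalProjectionOnto_eq_of_mem_right z (T (x : E)) 
    have h2 : inner ℝ x (T' z) = inner ℝ (x : E) (T (z : E)) := by
      simp only [T', P, LinearMap.comp_apply, Submodule.subtype_apply,
        ContinuousLinearMap.coe_coe]
      rw [Submodule.coe_inner]
      exact Submodule.inner_orthogonalProjectionOnto_eq_of_mem_left x (T (z : E)) 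
    rw [h1, h2, hT]
  let B := hT'.eigenvectorBasis (rfl : Module.finrank ℝ K = Module.finrank ℝ K)
  let v := hT'.eigenvalues (rfl : Module.finrank ℝ K = Module.finrank ℝ K)
  have hN : 0 < inner ℝ b b := real_inner_self_pos.2 hb
  set N : ℝ := inner ℝ b b with hNdef
  have hdec : ∀ x : E, x = (P x : E) + (inner ℝ b x / N) • b := by
    intro x
    have h1 := Submodule.starProjection_add_starProjection_orthogonal (K := (ℝ ∙ b)) x
    have h2 : (ℝ ∙ b).starProjection x = (inner ℝ b x / N) • b := by
      rw [Submodule.starProjection_singleton]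
      congr 1
      rw [hNdef, real_inner_self_eq_norm_sq]; simp
    rw [h2] at h1
    rw [add_comm]
    exact h1.symm
  have hyb : ∀ i, inner ℝ (B i : E) b = 0 := by
    intro i
    have := (B i).2
    exact Submodule.mem_orthogonal_singleton_iff_inner_left.1 this
  have hTy : ∀ i, T (B i : E) = v i • (B i : E) + (inner ℝ b (T (B i)) / N) • b := by
    intro i
    have h1 : T' (B i) = v i • B i := hT'.apply_eigenvectorBasis rfl i
    have h2 := hdec (T (B i))
    have h3 : ((P (T (B i)) : K) : E) = v i • (B i : E) := by
      have := congrArg (Subtype.val) h1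
      simpa [T'] using this
    rw [h3] at h2
    exact h2
  have hnorm : ∀ i, inner ℝ (B i : E) (B i : E) = 1 := by
    intro i
    have := B.orthonormal.1 i
    rw [real_inner_self_eq_norm_sq]
    have h2 : ‖(B i : E)‖ = 1 := this
    rw [h2]; norm_num
  have hv : ∀ i, 0 < v i := by
    intro i
    have hne : (B i : E) ≠ 0 := by
      intro h; have := hnorm i; rw [h] at this; simp at this
    have := hpos _ hne
    rw [hTy i, inner_add_right, inner_smul_right, inner_smul_right, hnorm, hyb] at this
    simpa using this
  obtain ⟨k, hk⟩ : ∃ k : Fin (Module.finrank ℝ K) → ℝ, k = fun i => inner ℝ b (T (B i)) / N :=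
    ⟨_, rfl⟩
  replace hTy : ∀ i, T (B i : E) = v i • (B i : E) + k i • b := by
    intro i; rw [hk]; exact hTy i
  have hTb : T b = (inner ℝ b (T b) / N) • b + ∑ i, (N * k i) • (B i : E) := by
    have h1 := hdec (T b)
    have h2 := B.sum_repr' (P (T b))
    have h3 : ((P (T b) : K) : E) = ∑ i, (N * k i) • (B i : E) := by
      rw [← h2]
      push_cast
      refine Finset.sum_congr rfl fun i _ => ?_
      congr 1
      have : inner ℝ (B i) (P (T b)) = inner ℝ (B i : E) (T b) := by
        rw [Submodule.coe_inner]
        exact Submodule.inner_orthogonalProjectionOnto_eq_of_mem_left (B i) (T b)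
      rw [this, hk, mul_div_cancel₀ _ hN.ne', ← hT, real_inner_comm]
    rw [h3] at h1
    rw [add_comm]; exact h1
  refine ⟨_, fun i => (B i : E), v, k, inner ℝ b (T b) / N, N, hN, hyb, hv, hTy, hTb, ?_⟩
  set d := inner ℝ b (T b) / N
  let xi : E := b - ∑ i, (N * k i / v i) • (B i : E)
  have hxb : inner ℝ xi b = N := by
    simp only [xi, inner_sub_left, sum_inner, inner_smul_left, hyb]
    simp [hNdef]
  have hTx : T xi = (d - N * ∑ i, (k i) ^ 2 / v i) • b := by
    simp only [xi, map_sub, map_sum, map_smul, hTy]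
    rw [hTb]
    simp only [smul_add, Finset.sum_add_distrib, smul_smul]
    have e1 : ∀ i, N * k i / v i * v i = N * k i := fun i => by
      have := (hv i).ne'; field_simp
    simp only [e1]
    rw [← Finset.sum_smul]
    have e2 : ∑ i, N * k i / v i * k i = N * ∑ i, (k i) ^ 2 / v i := by
      rw [Finset.mul_sum]
      refine Finset.sum_congr rfl fun i _ => ?_
      ring
    rw [e2, sub_smul]
    abel
  have hxi : xi ≠ 0 := by
    intro h; rw [h] at hxb; simp at hxb; exact hN.ne hxb
  have := hpos xi hxi
  rw [hTx, inner_smul_right, hxb] at this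
  exact pos_of_mul_pos_left this hN.le

theorem ax_exists_max {f : ℝ → ℝ} (hc : Continuous f) (h0 : Tendsto f (cocompact ℝ) (𝓝 0))
    {x : ℝ} (hx : 0 < f x) : ∃ z, ∀ y, f y ≤ f z := by
  refine hc.exists_forall_ge' x ?_
  filter_upwards [h0.eventually (eventually_lt_nhds hx)] with y hy using hy.le

theorem ax_core {E : Type*} [NormedAddCommGroup E] [InnerProductSpace ℝ E]
    [FiniteDimensional ℝ E] (T : E →ₗ[ℝ] E) (hT : T.IsSymmetric)
    (hpos : ∀ x : E, x ≠ 0 → 0 < inner ℝ x (T x)) (b : E) (hb : b ≠ 0)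
    (Φ : E →ₗ[ℝ] (ℝ → ℝ)) (S : Finset ℝ) (hcont : ∀ c, Continuous (Φ c))
    (hzero : ∀ c, Tendsto (Φ c) (cocompact ℝ) (𝓝 0))
    (hdiff : ∀ c x, (inner ℝ c b = 0 ∨ x ∉ S) →
      Tendsto (fun ε : ℝ => (Φ c (x + ε) + Φ c (x - ε) - 2 * Φ c x) / ε ^ 2) (𝓝[>] 0)
        (𝓝 (Φ (T c) x)))
    (x : ℝ) (hx : 0 < Φ b x) (hmax : ∀ y, Φ b y ≤ Φ b x) : x ∈ S := by
  by_contra hxS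
  obtain ⟨n, y, v, k, d, N, hN, hyb, hv, hTy, hTb, hd⟩ := ax_spectral T hT hpos b hb
  set m := Φ b x with hm
  have hz : ∀ i z, -((k i) ^ 2 / v i * m) ≤ k i * Φ (y i) z := by
    intro i z
    by_contra! hlt
    set c : E := (-(k i)) • y i with hc
    have hcz : ∀ z, Φ c z = -(k i * Φ (y i) z) := by
      intro z; simp [hc]
    have hq : 0 ≤ (k i) ^ 2 / v i * m := by have := hv i; positivity
    have hpz : 0 < Φ c z := by rw [hcz]; linarith
    obtain ⟨q, hq'⟩ := ax_exists_max (hcont c) (hzero c) hpz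
    have hcb : inner ℝ c b = 0 := by rw [hc, inner_smul_left, hyb]; simp
    have hle : Φ (T c) q ≤ 0 := by
      refine le_of_tendsto (hdiff c q (Or.inl hcb)) ?_
      filter_upwards [self_mem_nhdsWithin] with ε hε
      refine div_nonpos_of_nonpos_of_nonneg ?_ (by positivity)
      linarith [hq' (q + ε), hq' (q - ε)]
    have hTc : Φ (T c) q = v i * Φ c q - (k i) ^ 2 * Φ b q := by
      rw [hcz]
      simp only [hc, map_smul, hTy, map_add, Pi.smul_apply, Pi.add_apply, smul_eq_mul]
      ring
    have h1 : v i * Φ c q ≤ (k i) ^ 2 * m := by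
      have : (k i) ^ 2 * Φ b q ≤ (k i) ^ 2 * m := by gcongr; exact hmax q
      linarith
    have h2 : Φ c q ≤ (k i) ^ 2 / v i * m := by
      rw [div_mul_eq_mul_div, le_div_iff₀ (hv i)]; linarith
    have := hq' z
    rw [hcz z] at this
    linarith
  have hle : Φ (T b) x ≤ 0 := by
    refine le_of_tendsto (hdiff b x (Or.inr hxS)) ?_
    filter_upwards [self_mem_nhdsWithin] with ε hε
    refine div_nonpos_of_nonpos_of_nonneg ?_ (by positivity)
    linarith [hmax (x + ε), hmax (x - ε)]
  have hTb' : Φ (T b) x = d * m + N * ∑ i, k i * Φ (y i) x := by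
    rw [hTb]
    simp only [map_add, map_sum, map_smul, Pi.smul_apply, Pi.add_apply, smul_eq_mul,
      Finset.sum_apply, Finset.mul_sum, mul_assoc, hm]
  have hsum : -((∑ i, (k i) ^ 2 / v i) * m) ≤ ∑ i, k i * Φ (y i) x := by
    rw [Finset.sum_mul, ← Finset.sum_neg_distrib]
    exact Finset.sum_le_sum fun i _ => hz i x
  have : 0 < (d - N * ∑ i, (k i) ^ 2 / v i) * m := mul_pos hd hx
  nlinarith [mul_le_mul_of_nonneg_left hsum hN.le]

theorem ax_exp_lim : Tendsto (fun y : ℝ => (Real.exp y - 1 - y) / y ^ 2) (𝓝[≠] 0) (𝓝 (1 / 2)) := by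
  rw [tendsto_iff_norm_sub_tendsto_zero]
  have h1 : Tendsto (fun y : ℝ => |y| ) (𝓝[≠] 0) (𝓝 0) := by
    have : Tendsto (fun y : ℝ => |y|) (𝓝 0) (𝓝 |0|) := continuous_abs.tendsto 0
    rw [abs_zero] at this
    exact this.mono_left nhdsWithin_le_nhds
  refine squeeze_zero' (Eventually.of_forall fun _ => norm_nonneg _) ?_ h1
  have h2 : ∀ᶠ y : ℝ in 𝓝[≠] 0, |y| < 1 := h1.eventually (eventually_lt_nhds one_pos)
  filter_upwards [h2, self_mem_nhdsWithin] with y hy hy0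
  have hy0 : y ≠ 0 := hy0
  have := Real.exp_bound hy.le (n := 3) (by norm_num)
  simp [Finset.sum_range_succ, Nat.factorial] at this
  have e : (Real.exp y - 1 - y) / y ^ 2 - 1 / 2 = (Real.exp y - (1 + y + y ^ 2 / 2)) / y ^ 2 := by
    field_simp; ring
  rw [e, Real.norm_eq_abs, abs_div, abs_of_nonneg (sq_nonneg y), div_le_iff₀ (by positivity),
    show |y| * y ^ 2 = |y| * |y| ^ 2 by rw [sq_abs]]
  refine this.trans ?_
  have : 0 ≤ |y| ^ 3 := by positivity
  nlinarith

noncomputable def axE (u x : ℝ) : ℝ := Real.exp (-(u * |x|)) / (2 * u)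

theorem axE_diff {u : ℝ} (hu : 0 < u) (x : ℝ) :
    Tendsto (fun ε : ℝ => (axE u (x + ε) + axE u (x - ε) - 2 * axE u x) / ε ^ 2
      + (if x = 0 then 1 / ε else 0)) (𝓝[>] 0) (𝓝 (u ^ 2 * axE u x)) := by
  have hp : Tendsto (fun ε : ℝ => u * ε) (𝓝[>] 0) (𝓝[≠] 0) := by
    refine tendsto_nhdsWithin_iff.2 ⟨?_, ?_⟩
    · have : Tendsto (fun ε : ℝ => u * ε) (𝓝 0) (𝓝 (u * 0)) := by
        apply Continuous.tendsto; fun_prop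
      rw [mul_zero] at this
      exact this.mono_left nhdsWithin_le_nhds
    · filter_upwards [self_mem_nhdsWithin] with ε hε
      exact (mul_pos hu hε).ne'
  have hn : Tendsto (fun ε : ℝ => -(u * ε)) (𝓝[>] 0) (𝓝[≠] 0) := by
    refine tendsto_nhdsWithin_iff.2 ⟨?_, ?_⟩
    · have : Tendsto (fun ε : ℝ => -(u * ε)) (𝓝 0) (𝓝 (-(u * 0))) := by
        apply Continuous.tendsto; fun_prop
      rw [mul_zero, neg_zero] at this
      exact this.mono_left nhdsWithin_le_nhds
    · filter_upwards [self_mem_nhdsWithin] with ε hε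
      exact neg_ne_zero.2 (mul_pos hu hε).ne'
  have Lp := ax_exp_lim.comp hp
  have Ln := ax_exp_lim.comp hn
  by_cases hx : x = 0
  · subst hx
    have := Ln.const_mul u
    have e : u ^ 2 * axE u 0 = u * (1 / 2) := by
      simp [axE]; field_simp
    rw [e]
    refine this.congr' ?_
    filter_upwards [self_mem_nhdsWithin] with ε hε
    have hε : 0 < ε := hε
    simp only [axE, Function.comp, zero_add, zero_sub, abs_neg, abs_of_pos hε, if_true, abs_zero,
      mul_zero, neg_zero, Real.exp_zero]
    field_simp
    ring
  · have := (Lp.add Ln).const_mul (u ^ 2 * axE u x)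
    have e : u ^ 2 * axE u x * (1 / 2 + 1 / 2) = u ^ 2 * axE u x := by ring
    rw [e] at this
    refine this.congr' ?_
    have hlt : ∀ᶠ ε : ℝ in 𝓝[>] 0, ε < |x| :=
      (eventually_lt_nhds (abs_pos.2 hx)).filter_mono nhdsWithin_le_nhds
    filter_upwards [self_mem_nhdsWithin, hlt] with ε hε hε2
    have hε : 0 < ε := hε
    simp only [axE, Function.comp, hx, if_false, add_zero]
    have key : Real.exp (-(u * |x + ε|)) + Real.exp (-(u * |x - ε|))
        = Real.exp (-(u * |x|)) * (Real.exp (u * ε) + Real.exp (-(u * ε))) := by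
      rw [mul_add, ← Real.exp_add, ← Real.exp_add]
      rcases lt_or_gt_of_ne hx with h | h
      · rw [abs_of_neg h] at hε2 ⊢
        rw [abs_of_neg (by linarith), abs_of_neg (by linarith)]
        congr 2 <;> ring
      · rw [abs_of_pos h] at hε2 ⊢
        rw [abs_of_pos (by linarith), abs_of_pos (by linarith), add_comm]
        congr 2 <;> ring
    rw [← add_div, key]
    field_simp
    ring

theorem axE_cont {u : ℝ} (s : ℝ) : Continuous (fun x => axE u (x - s)) := by
  unfold axE; fun_prop

theorem axE_zero {u : ℝ} (hu : 0 < u) (s : ℝ) :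
    Tendsto (fun x => axE u (x - s)) (cocompact ℝ) (𝓝 0) := by
  have h1 : Tendsto (fun x : ℝ => |x - s|) (cocompact ℝ) atTop := by
    have h := tendsto_norm_cocompact_atTop (E := ℝ)
    have h' := tendsto_atTop_add_const_right _ (-|s|) h
    refine tendsto_atTop_mono (fun x => ?_) h'
    have := abs_sub_abs_le_abs_sub x s
    rw [Real.norm_eq_abs]; linarith
  have h2 := (Real.tendsto_exp_neg_atTop_nhds_zero.comp (h1.const_mul_atTop hu)).div_const (2 * u)
  simpa [axE, Function.comp_def] using h2

theorem ax_mix {ι τ : Type} [Fintype ι] [Fintype τ] (w u : ι → ℝ) (hw : ∀ j, 0 ≤ w j)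
    (hu : ∀ j, 0 < u j) (σ a : τ → ℝ) (x : ℝ) :
    (∑ t, a t * ∑ j, w j * Real.exp (-(u j * |x - σ t|)) ≤ 0) ∨
    ∃ t', ∑ t, a t * ∑ j, w j * Real.exp (-(u j * |x - σ t|)) ≤
      ∑ t, a t * ∑ j, w j * Real.exp (-(u j * |σ t' - σ t|)) := by
  classical

  let β : ι → ℝ := fun j => Real.sqrt (2 * w j * u j)
  have hβ : ∀ j, β j * β j = 2 * w j * u j := fun j =>
    Real.mul_self_sqrt (by have := hw j; have := hu j; positivity)
  let b : EuclideanSpace ℝ ι := WithLp.toLp 2 β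
  let Φ : EuclideanSpace ℝ ι →ₗ[ℝ] (ℝ → ℝ) :=
    { toFun := fun c x => ∑ j, c j * (β j * ∑ t, a t * axE (u j) (x - σ t))
      map_add' := by
        intro c c'; funext x
        simp [add_mul, Finset.sum_add_distrib]
      map_smul' := by
        intro r c; funext x
        simp [mul_assoc, Finset.mul_sum] }
  let T : EuclideanSpace ℝ ι →ₗ[ℝ] EuclideanSpace ℝ ι :=
    { toFun := fun c => WithLp.toLp 2 fun j => u j ^ 2 * c j
      map_add' := by
        intro c c'; ext j; simp [mul_add]
      map_smul' := by
        intro r c; ext j; simp [mul_left_comm] }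
  have hΦ : ∀ c x, Φ c x = ∑ j, c j * (β j * ∑ t, a t * axE (u j) (x - σ t)) := fun _ _ => rfl
  have hTc : ∀ c j, (T c) j = u j ^ 2 * c j := fun _ _ => rfl
  have hinner : ∀ c c' : EuclideanSpace ℝ ι, inner ℝ c c' = ∑ j, c j * c' j := by
    intro c c'
    simp [PiLp.inner_apply, mul_comm]
  have hΦb : ∀ x, Φ b x = ∑ t, a t * ∑ j, w j * Real.exp (-(u j * |x - σ t|)) := by
    intro x
    rw [hΦ]
    simp only [Finset.mul_sum]
    rw [Finset.sum_comm]
    refine Finset.sum_congr rfl fun t _ => Finset.sum_congr rfl fun j _ => ?_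
    have : (b j) = β j := rfl
    rw [this]
    have h1 := hβ j
    have h2 := (hu j).ne'
    calc β j * (β j * (a t * axE (u j) (x - σ t)))
        = (β j * β j) * (a t * axE (u j) (x - σ t)) := by ring
      _ = _ := by rw [h1, axE]; field_simp
  simp only [← hΦb]
  by_cases hb : b = 0
  · left; rw [hb]; simp
  have hT : T.IsSymmetric := by
    intro c c'
    rw [hinner, hinner]
    refine Finset.sum_congr rfl fun j _ => ?_
    rw [hTc, hTc]; ring
  have hpos : ∀ c : EuclideanSpace ℝ ι, c ≠ 0 → 0 < inner ℝ c (T c) := by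
    intro c hc
    rw [hinner]
    have : ∃ j, c j ≠ 0 := by
      by_contra! h; exact hc (by ext j; exact h j)
    obtain ⟨j, hj⟩ := this
    refine Finset.sum_pos' (fun i _ => ?_) ⟨j, Finset.mem_univ _, ?_⟩
    · rw [hTc]; nlinarith [mul_nonneg (sq_nonneg (u i)) (sq_nonneg (c i))]
    · rw [hTc]
      have : 0 < u j ^ 2 * (c j) ^ 2 := by have := hu j; positivity
      nlinarith
  have hcont : ∀ c, Continuous (Φ c) := by
    intro c
    have : Φ c = fun x => ∑ j, c j * (β j * ∑ t, a t * axE (u j) (x - σ t)) := rfl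
    rw [this]
    refine continuous_finsetSum _ fun j _ => continuous_const.mul (continuous_const.mul ?_)
    exact continuous_finsetSum _ fun t _ => continuous_const.mul (axE_cont _)
  have hzero : ∀ c, Tendsto (Φ c) (cocompact ℝ) (𝓝 0) := by
    intro c
    have : Φ c = fun x => ∑ j, c j * (β j * ∑ t, a t * axE (u j) (x - σ t)) := rfl
    rw [this]
    have h := tendsto_finsetSum (Finset.univ : Finset ι) fun j _ =>
      ((tendsto_finsetSum (Finset.univ : Finset τ) fun t _ =>
        (axE_zero (hu j) (σ t)).const_mul (a t)).const_mul (β j)).const_mul (c j)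
    simpa using h
  have hdiff : ∀ c x, (inner ℝ c b = 0 ∨ x ∉ Finset.univ.image σ) →
      Tendsto (fun ε : ℝ => (Φ c (x + ε) + Φ c (x - ε) - 2 * Φ c x) / ε ^ 2) (𝓝[>] 0)
        (𝓝 (Φ (T c) x)) := by
    intro c x hcx
    have h := tendsto_finsetSum (Finset.univ : Finset ι) fun j _ =>
      ((tendsto_finsetSum (Finset.univ : Finset τ) fun t _ =>
        (axE_diff (hu j) (x - σ t)).const_mul (a t)).const_mul (β j)).const_mul (c j)
    have e1 : Φ (T c) x = ∑ j, c j * (β j * ∑ t, a t * (u j ^ 2 * axE (u j) (x - σ t))) := by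
      rw [hΦ]
      refine Finset.sum_congr rfl fun j _ => ?_
      rw [hTc]
      simp only [Finset.mul_sum]
      refine Finset.sum_congr rfl fun t _ => ?_
      ring
    rw [e1]
    refine h.congr fun ε => ?_
    have e2 : ∑ j, c j * (β j * ∑ t, a t * (if x - σ t = 0 then 1 / ε else 0)) = 0 := by
      rcases hcx with h0 | h0
      · rw [hinner] at h0
        have : ∀ j, c j * (β j * ∑ t, a t * (if x - σ t = 0 then 1 / ε else 0))
          = (c j * b j) * ∑ t, a t * (if x - σ t = 0 then 1 / ε else 0) := fun j => by
            rw [mul_assoc]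
        simp only [this]
        rw [← Finset.sum_mul, h0, zero_mul]
      · refine Finset.sum_eq_zero fun j _ => ?_
        rw [Finset.sum_eq_zero, mul_zero, mul_zero]
        intro t _
        rw [if_neg, mul_zero]
        intro h1
        exact h0 (Finset.mem_image.2 ⟨t, Finset.mem_univ _, (sub_eq_zero.1 h1).symm⟩)
    rw [hΦ, hΦ, hΦ]
    simp only [mul_add, Finset.sum_add_distrib, e2, add_zero]
    rw [Finset.mul_sum, ← Finset.sum_add_distrib, ← Finset.sum_sub_distrib, Finset.sum_div]
    refine Finset.sum_congr rfl fun j _ => ?_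
    simp only [Finset.mul_sum, Finset.sum_div]
    rw [← Finset.sum_add_distrib, ← Finset.sum_sub_distrib, Finset.sum_div]
    refine Finset.sum_congr rfl fun t _ => ?_
    rw [show x + ε - σ t = x - σ t + ε by ring, show x - ε - σ t = x - σ t - ε by ring]
    ring
  by_contra! hcon
  obtain ⟨h0, h1⟩ := hcon
  obtain ⟨z, hz⟩ := ax_exists_max (hcont b) (hzero b) h0
  have hzS := ax_core T hT hpos b hb Φ _ hcont hzero hdiff z (h0.trans_le (hz x)) hz
  obtain ⟨t, -, rfl⟩ := Finset.mem_image.1 hzS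
  exact absurd (hz x) (not_le.2 (h1 t))

def axGen {ι : Type} (ρ : ι → ℝ) : Submonoid (ι → ℝ) where
  carrier := {f | ∃ c u : ℝ, 0 ≤ c ∧ 0 ≤ u ∧ f = fun i => c * Real.exp (-(u * |ρ i|))}
  one_mem' := ⟨1, 0, zero_le_one, le_rfl, by funext i; simp⟩
  mul_mem' := by
    rintro f f' ⟨c, u, hc, hu, rfl⟩ ⟨c', u', hc', hu', rfl⟩
    refine ⟨c * c', u + u', mul_nonneg hc hc', add_nonneg hu hu', ?_⟩
    funext i
    simp only [Pi.mul_apply]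
    rw [show -((u + u') * |ρ i|) = -(u * |ρ i|) + -(u' * |ρ i|) by ring, Real.exp_add]
    ring

def axC {ι : Type} (ρ : ι → ℝ) : Subsemiring (ι → ℝ) :=
  (axGen ρ).subsemiringClosure.topologicalClosure

theorem axC_closed {ι : Type} (ρ : ι → ℝ) : IsClosed (axC ρ : Set (ι → ℝ)) :=
  Subsemiring.isClosed_topologicalClosure _

theorem axC_gen {ι : Type} (ρ : ι → ℝ) {c u : ℝ} (hc : 0 ≤ c) (hu : 0 ≤ u) :
    (fun i => c * Real.exp (-(u * |ρ i|))) ∈ axC ρ :=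
  Subsemiring.le_topologicalClosure _ (AddSubmonoid.subset_closure ⟨c, u, hc, hu, rfl⟩)

theorem axC_const {ι : Type} (ρ : ι → ℝ) {c : ℝ} (hc : 0 ≤ c) :
    (fun _ => c : ι → ℝ) ∈ axC ρ := by
  have := axC_gen ρ hc le_rfl
  simpa using this

theorem ax_form {ι : Type} (ρ : ι → ℝ) {f : ι → ℝ} (hf : f ∈ (axGen ρ).subsemiringClosure) :
    ∃ (J : Type) (_ : Fintype J) (w u : J → ℝ), (∀ j, 0 ≤ w j) ∧ (∀ j, 0 ≤ u j) ∧
      ∀ i, f i = ∑ j, w j * Real.exp (-(u j * |ρ i|)) := by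
  have hf' : f ∈ AddSubmonoid.closure (axGen ρ : Set (ι → ℝ)) := hf
  clear hf
  induction hf' using AddSubmonoid.closure_induction with
  | mem f hf =>
    obtain ⟨c, u, hc, hu, rfl⟩ := hf
    exact ⟨Unit, inferInstance, fun _ => c, fun _ => u, fun _ => hc, fun _ => hu, by simp⟩
  | zero => exact ⟨Empty, inferInstance, fun _ => 0, fun _ => 0, by simp, by simp, by simp⟩
  | add f f' hf hf' ih ih' =>
    obtain ⟨J, _, w, u, hw, hu, h⟩ := ih
    obtain ⟨J', _, w', u', hw', hu', hsecond⟩ := ih'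
    refine ⟨J ⊕ J', inferInstance, Sum.elim w w', Sum.elim u u', ?_, ?_, ?_⟩
    · rintro (j | j); exacts [hw j, hw' j]
    · rintro (j | j); exacts [hu j, hu' j]
    · intro i; simp [h, hsecond]

/-- the weak maximum principle as a closed condition -/
def axW {τ : Type} [Fintype τ] (a : τ → ℝ) : Set (Option τ × τ → ℝ) :=
  {f | ∑ t, a t * f (none, t) ≤ 0} ∪ ⋃ t', {f | ∑ t, a t * f (none, t) ≤ ∑ t, a t * f (some t', t)}

theorem axW_closed {τ : Type} [Fintype τ] (a : τ → ℝ) : IsClosed (axW a) := by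
  refine IsClosed.union ?_ (isClosed_iUnion_of_finite fun t' => ?_)
  · exact isClosed_le (by fun_prop) (by fun_prop)
  · exact isClosed_le (by fun_prop) (by fun_prop)

def axPt {τ : Type} (σ : τ → ℝ) (x : ℝ) : Option τ × τ → ℝ := fun q => q.1.elim x σ - σ q.2

theorem axC_sub_W {τ : Type} [Fintype τ] (σ a : τ → ℝ) (x : ℝ) {f : Option τ × τ → ℝ}
    (hf : f ∈ axC (axPt σ x)) : f ∈ axW a := by
  refine (closure_minimal ?_ (axW_closed a)) hf
  intro f hf
  obtain ⟨J, _, w, u, hw, hu, h⟩ := ax_form _ hf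
  have key : ∀ δ : ℝ, 0 < δ →
      (fun i => ∑ j, w j * Real.exp (-((u j + δ) * |axPt σ x i|))) ∈ axW a := by
    intro δ hδ
    rcases ax_mix w (fun j => u j + δ) hw (fun j => by have := hu j; linarith) σ a x with h | ⟨t, h⟩
    · exact Or.inl h
    · exact Or.inr (Set.mem_iUnion.2 ⟨t, h⟩)
  have hlim : Tendsto (fun δ : ℝ => (fun i => ∑ j, w j * Real.exp (-((u j + δ) * |axPt σ x i|))))
      (𝓝[>] 0) (𝓝 f) := by
    have hc : Continuous
        (fun δ : ℝ => (fun i => ∑ j, w j * Real.exp (-((u j + δ) * |axPt σ x i|)))) := by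
      fun_prop
    have := hc.tendsto 0
    have e : (fun i => ∑ j, w j * Real.exp (-((u j + 0) * |axPt σ x i|))) = f := by
      funext i; simp [h]
    rw [e] at this
    exact this.mono_left nhdsWithin_le_nhds
  refine (axW_closed a).mem_of_tendsto hlim ?_
  filter_upwards [self_mem_nhdsWithin] with δ hδ using key δ hδ

theorem axC_exp {ι : Type} (ρ : ι → ℝ) {f : ι → ℝ} (hf : f ∈ axC ρ) {c : ℝ} (hc : 0 ≤ c) :
    (fun i => Real.exp (c * f i)) ∈ axC ρ := by
  have hlim : Tendsto (fun n : ℕ => (fun i => (1 + c * f i / n) ^ n)) atTop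
      (𝓝 (fun i => Real.exp (c * f i))) := by
    rw [tendsto_pi_nhds]
    intro i
    exact Real.tendsto_one_add_div_pow_exp (c * f i)
  refine (axC_closed ρ).mem_of_tendsto hlim (Eventually.of_forall fun n => ?_)
  have h1 : (1 + (fun _ => c / n : ι → ℝ) * f) ^ n ∈ axC ρ :=
    pow_mem (add_mem (one_mem _) (mul_mem (axC_const ρ (by positivity)) hf)) n
  rw [SetLike.mem_coe]
  convert h1 using 1
  funext i
  simp only [Pi.pow_apply, Pi.add_apply, Pi.one_apply, Pi.mul_apply]
  ring

theorem axC_inv {ι : Type} (ρ : ι → ℝ) {t : ℝ} (ht : 0 < t) :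
    (fun i => t * (t + |ρ i|)⁻¹) ∈ axC ρ := by
  have h1 : ∀ h : ℝ, 0 < h → (fun i => t * (h / (1 - Real.exp (-(h * (t + |ρ i|)))))) ∈ axC ρ := by
    intro h hh
    have hlim : Tendsto (fun n : ℕ => (fun i => t * (h * ∑ k ∈ Finset.range n,
        (Real.exp (-(h * (t + |ρ i|)))) ^ k))) atTop
        (𝓝 (fun i => t * (h / (1 - Real.exp (-(h * (t + |ρ i|))))))) := by
      rw [tendsto_pi_nhds]
      intro i
      have hlt : Real.exp (-(h * (t + |ρ i|))) < 1 := by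
        rw [Real.exp_lt_one_iff]
        have : 0 < h * (t + |ρ i|) := by positivity
        linarith
      have := (hasSum_geometric_of_lt_one (Real.exp_pos _).le hlt).tendsto_sum_nat
      rw [div_eq_mul_inv]
      exact (this.const_mul h).const_mul t
    refine (axC_closed ρ).mem_of_tendsto hlim (Eventually.of_forall fun n => ?_)
    have hg : (fun i => Real.exp (-(h * t)) * Real.exp (-(h * |ρ i|))) ∈ axC ρ :=
      axC_gen ρ (Real.exp_pos _).le hh.le
    have h2 : (fun _ => t : ι → ℝ) * ((fun _ => h : ι → ℝ) * ∑ k ∈ Finset.range n,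
        (fun i => Real.exp (-(h * t)) * Real.exp (-(h * |ρ i|))) ^ k) ∈ axC ρ :=
      mul_mem (axC_const ρ ht.le) (mul_mem (axC_const ρ hh.le)
        (sum_mem fun k _ => pow_mem hg k))
    rw [SetLike.mem_coe]
    convert h2 using 1
    funext i
    simp only [Pi.mul_apply, Finset.sum_apply, Pi.pow_apply]
    rw [← Real.exp_add]
    ring_nf
  have hlim : Tendsto (fun h : ℝ => (fun i => t * (h / (1 - Real.exp (-(h * (t + |ρ i|)))))))
      (𝓝[>] 0) (𝓝 (fun i => t * (t + |ρ i|)⁻¹)) := by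
    rw [tendsto_pi_nhds]
    intro i
    have hy : 0 < t + |ρ i| := by positivity
    set y := t + |ρ i|
    have hd : HasDerivAt (fun h : ℝ => 1 - Real.exp (-(h * y))) y 0 := by
      have := (((hasDerivAt_id (0 : ℝ)).mul_const y).neg.exp).const_sub 1
      simpa using this
    have := hd.tendsto_slope_zero_right
    have := (this.inv₀ hy.ne').const_mul t
    refine this.congr fun h => ?_
    simp [div_eq_mul_inv, mul_comm]
  refine (axC_closed ρ).mem_of_tendsto hlim ?_
  filter_upwards [self_mem_nhdsWithin] with h hh using h1 h hh

/-- functions `ψ` such that all `exp (-c ψ)` lie in the closed semiring -/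
def axB {ι : Type} (ρ : ι → ℝ) : Set (ι → ℝ) :=
  {ψ | ∀ c : ℝ, 0 ≤ c → (fun i => Real.exp (-(c * ψ i))) ∈ axC ρ}

theorem axB_closed {ι : Type} (ρ : ι → ℝ) : IsClosed (axB ρ) := by
  have : axB ρ = ⋂ (c : ℝ) (_ : 0 ≤ c),
      (fun ψ : ι → ℝ => (fun i => Real.exp (-(c * ψ i)))) ⁻¹' (axC ρ : Set (ι → ℝ)) := by
    ext ψ; simp [axB]
  rw [this]
  refine isClosed_iInter fun c => isClosed_iInter fun _ => (axC_closed ρ).preimage ?_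
  fun_prop

theorem axB_smul {ι : Type} (ρ : ι → ℝ) {ψ : ι → ℝ} (h : ψ ∈ axB ρ) {r : ℝ} (hr : 0 ≤ r) :
    r • ψ ∈ axB ρ := by
  intro c hc
  have := h (c * r) (mul_nonneg hc hr)
  simpa [mul_assoc] using this

theorem axB_add {ι : Type} (ρ : ι → ℝ) {ψ ψ' : ι → ℝ} (h : ψ ∈ axB ρ) (h' : ψ' ∈ axB ρ) :
    ψ + ψ' ∈ axB ρ := by
  intro c hc
  have := mul_mem (h c hc) (h' c hc)
  convert this using 1
  funext i
  simp only [Pi.add_apply, Pi.mul_apply]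
  rw [← Real.exp_add]; ring_nf

theorem axB_int {ι : Type} [Fintype ι] (ρ : ι → ℝ) (μ : MeasureTheory.Measure ℝ)
    (F : ℝ → ι → ℝ) (hF : ∀ᵐ t ∂μ, F t ∈ axB ρ)
    (hint : ∀ i, MeasureTheory.Integrable (fun t => F t i) μ) :
    (fun i => ∫ t, F t i ∂μ) ∈ axB ρ := by
  classical
  by_contra hcon
  have hconv : Convex ℝ (axB ρ) := by
    intro x hx y hy a b ha hb _
    exact axB_add ρ (axB_smul ρ hx ha) (axB_smul ρ hy hb)
  obtain ⟨L, u, h1, h2⟩ := geometric_hahn_banach_closed_point hconv (axB_closed ρ) hcon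
  have h0 : (0 : ι → ℝ) ∈ axB ρ := by
    intro c hc
    simpa using axC_const ρ zero_le_one
  have hu : 0 < u := by simpa using h1 0 h0
  have hneg : ∀ ψ ∈ axB ρ, L ψ ≤ 0 := by
    intro ψ hψ
    by_contra! hp
    have := h1 _ (axB_smul ρ hψ (r := u / L ψ) (by positivity))
    rw [map_smul, smul_eq_mul, div_mul_cancel₀ _ hp.ne'] at this
    exact lt_irrefl _ this
  have hL : ∀ ψ : ι → ℝ, L ψ = ∑ i, ψ i * L (Pi.single i 1) := by
    intro ψ
    conv_lhs => rw [pi_eq_sum_univ' ψ]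
    simp
  have e : L (fun i => ∫ t, F t i ∂μ) = ∫ t, L (F t) ∂μ := by
    obtain ⟨l, hl⟩ : ∃ l : ι → ℝ, ∀ ψ : ι → ℝ, L ψ = ∑ i, ψ i * l i := ⟨_, hL⟩
    simp only [hl]
    rw [MeasureTheory.integral_finsetSum _ fun i _ => (hint i).mul_const _]
    simp only [MeasureTheory.integral_mul_const]
  rw [e] at h2
  have : ∫ t, L (F t) ∂μ ≤ 0 := by
    refine MeasureTheory.integral_nonpos_of_ae ?_
    filter_upwards [hF] with t ht using hneg _ ht
  linarith

theorem axC_rpow {ι : Type} [Fintype ι] (ρ : ι → ℝ) {lam p : ℝ} (hlam : 0 < lam) (hp0 : 0 < p)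
    (hp1 : p ≤ 1) : (fun i => Real.exp (-(lam * |ρ i| ^ p))) ∈ axC ρ := by
  rcases hp1.eq_or_lt with rfl | hp1
  · have := axC_gen ρ zero_le_one hlam.le
    simpa using this
  have hp : p ∈ Set.Ioo (0 : ℝ) 1 := ⟨hp0, hp1⟩
  have h1 : ∀ t : ℝ, 0 < t → (fun i => Real.rpowIntegrand₀₁ p t |ρ i|) ∈ axB ρ := by
    intro t ht c hc
    have hq := axC_inv ρ ht
    have hcc : 0 ≤ c * (t ^ p * t⁻¹) := by positivity
    have := mul_mem (axC_const ρ (Real.exp_pos (-(c * (t ^ p * t⁻¹)))).le) (axC_exp ρ hq hcc)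
    convert this using 1
    funext i
    simp only [Pi.mul_apply]
    rw [← Real.exp_add, Real.rpowIntegrand₀₁]
    congr 1
    have : 0 < t + |ρ i| := by positivity
    field_simp
    ring
  have h2 := axB_int ρ (MeasureTheory.volume.restrict (Set.Ioi 0))
    (fun t i => Real.rpowIntegrand₀₁ p t |ρ i|)
    (MeasureTheory.ae_restrict_of_forall_mem measurableSet_Ioi fun t ht => h1 t ht)
    (fun i => Real.integrableOn_rpowIntegrand₀₁_Ioi hp (abs_nonneg _))
  have h3 := h2 (lam * (∫ t in Set.Ioi 0, Real.rpowIntegrand₀₁ p t 1)⁻¹)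
    (by have := Real.integral_rpowIntegrand₀₁_one_pos hp; positivity)
  convert h3 using 1
  funext i
  rw [Real.rpow_eq_const_mul_integral hp (abs_nonneg (ρ i)), mul_assoc]

theorem ax_weak {lam p : ℝ} (hlam : 0 < lam) (hp0 : 0 < p) (hp1 : p ≤ 1)
    {τ : Type} [Fintype τ] (σ a : τ → ℝ) (x : ℝ) :
    (∑ t, a t * Real.exp (-(lam * |x - σ t| ^ p)) ≤ 0) ∨
    ∃ t', ∑ t, a t * Real.exp (-(lam * |x - σ t| ^ p)) ≤
      ∑ t, a t * Real.exp (-(lam * |σ t' - σ t| ^ p)) := by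
  have := axC_sub_W σ a x (axC_rpow (axPt σ x) hlam hp0 hp1)
  rcases this with h | h
  · exact Or.inl h
  · obtain ⟨t, ht⟩ := Set.mem_iUnion.1 h
    exact Or.inr ⟨t, ht⟩

theorem ax_integrable {lam p : ℝ} (hlam : 0 < lam) (hp0 : 0 < p) :
    MeasureTheory.Integrable (fun x : ℝ => Real.exp (-(lam * |x| ^ p))) := by
  have h := integrableOn_rpow_mul_exp_neg_mul_rpow (s := 0) (by norm_num) hp0 hlam
  have h1 : MeasureTheory.IntegrableOn (fun x : ℝ => Real.exp (-(lam * |x| ^ p))) (Set.Ioi 0) := by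
    refine h.congr_fun (fun x hx => ?_) measurableSet_Ioi
    simp [abs_of_pos (Set.mem_Ioi.1 hx)]
  have h2 := (integrableOn_Ici_iff_integrableOn_Ioi
    (f := fun x : ℝ => Real.exp (-(lam * |x| ^ p))) (b := 0) (by simp)).2 h1
  have h3 : MeasureTheory.IntegrableOn (fun x : ℝ => Real.exp (-(lam * |x| ^ p))) (Set.Iic 0) := by
    have h4 := (MeasureTheory.integrable_indicator_iff measurableSet_Ici).2 h2
    have h5 := h4.comp_neg
    rw [← MeasureTheory.integrable_indicator_iff measurableSet_Iic]
    refine h5.congr (Eventually.of_forall fun x => ?_)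
    by_cases hx : x ≤ 0 <;> simp [Set.indicator, hx]
  have := h3.union h2
  rw [Set.Iic_union_Ici] at this
  exact MeasureTheory.integrableOn_univ.1 this

theorem ax_repr {lam p : ℝ} (hlam : 0 < lam) (hp0 : 0 < p) (hp1 : p ≤ 1) (S : Finset ℝ) (x : ℝ) :
    ∃ w : S → ℝ, (∀ s, 0 ≤ w s) ∧ ∑ s, w s ≤ 1 ∧
      ∀ s' : S, ∑ s : S, w s * Real.exp (-(lam * |(s : ℝ) - s'| ^ p)) =
        Real.exp (-(lam * |x - s'| ^ p)) := by
  classical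
  let K : Set (S → ℝ) := {w | (∀ s, 0 ≤ w s) ∧ ∑ s, w s ≤ 1}
  let T : (S → ℝ) → (S → ℝ) :=
    fun w s' => ∑ s : S, w s * Real.exp (-(lam * |(s : ℝ) - s'| ^ p))
  have hKc : IsCompact K := by
    refine (isCompact_Icc (a := (0 : S → ℝ)) (b := 1)).of_isClosed_subset ?_ ?_
    · have : K = (⋂ s, {w | 0 ≤ w s}) ∩ {w | ∑ s, w s ≤ 1} := by
        ext w; simp [K]
      rw [this]
      refine IsClosed.inter (isClosed_iInter fun s => isClosed_le ?_ ?_) (isClosed_le ?_ ?_) <;>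
        fun_prop
    · rintro w ⟨h1, h2⟩
      refine ⟨fun s => h1 s, fun s => ?_⟩
      exact (Finset.single_le_sum (fun i _ => h1 i) (Finset.mem_univ s)).trans h2
  have hT : Continuous T := by fun_prop
  have hQ : IsClosed (T '' K) := (hKc.image hT).isClosed
  have hconv : Convex ℝ (T '' K) := by
    rintro _ ⟨w, hw, rfl⟩ _ ⟨w', hw', rfl⟩ a b ha hb hab
    refine ⟨a • w + b • w', ⟨fun s => ?_, ?_⟩, ?_⟩
    · have := hw.1 s
      have := hw'.1 s
      simp only [Pi.add_apply, Pi.smul_apply, smul_eq_mul]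
      positivity
    · simp only [Pi.add_apply, Pi.smul_apply, smul_eq_mul, Finset.sum_add_distrib,
        ← Finset.mul_sum]
      nlinarith [hw.2, hw'.2]
    · funext s'
      simp only [T, Pi.add_apply, Pi.smul_apply, smul_eq_mul, Finset.mul_sum,
        ← Finset.sum_add_distrib]
      exact Finset.sum_congr rfl fun s _ => by ring
  by_cases hmem : (fun s' : S => Real.exp (-(lam * |x - s'| ^ p))) ∈ T '' K
  · obtain ⟨w, hw, e⟩ := hmem
    exact ⟨w, hw.1, hw.2, fun s' => congrFun e s'⟩
  exfalso
  obtain ⟨L, u, h1, h2⟩ := geometric_hahn_banach_closed_point hconv hQ hmem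
  obtain ⟨l, hl⟩ : ∃ l : S → ℝ, ∀ ψ : S → ℝ, L ψ = ∑ i, ψ i * l i := by
    refine ⟨fun i => L (Pi.single i 1), fun ψ => ?_⟩
    conv_lhs => rw [pi_eq_sum_univ' ψ]
    simp
  have hu : 0 < u := by
    have := h1 0 ⟨0, ⟨by simp, by simp⟩, by funext s; simp [T]⟩
    simpa using this
  have hs : ∀ s : S, ∑ t : S, l t * Real.exp (-(lam * |(s : ℝ) - t| ^ p)) < u := by
    intro s
    have := h1 (T (Pi.single s 1)) ⟨_, ⟨fun t => ?_, by simp⟩, rfl⟩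
    · rw [hl] at this
      refine lt_of_eq_of_lt (Finset.sum_congr rfl fun t _ => ?_) this
      simp only [T]
      rw [Finset.sum_eq_single s]
      · simp [mul_comm]
      · intro b _ hb; simp [hb]
      · simp
    · by_cases h : t = s
      · subst h; simp
      · simp [h]
  rw [hl] at h2
  simp only [mul_comm _ (l _)] at h2
  rcases ax_weak hlam hp0 hp1 (fun s : S => (s : ℝ)) l x with h | ⟨s, h⟩
  · linarith
  · linarith [hs s]

theorem ax_strict {lam p : ℝ} (hlam : 0 < lam) (hp0 : 0 < p) (hp1 : p ≤ 1) (S : Finset ℝ)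
    (a : S → ℝ) (x : ℝ) (hx : x ∉ S)
    (hne : ∃ y : ℝ, ∑ s : S, a s * Real.exp (-(lam * |y - s| ^ p)) ≠ 0) :
    ∃ s' : S, |∑ s : S, a s * Real.exp (-(lam * |x - s| ^ p))| <
      |∑ s : S, a s * Real.exp (-(lam * |(s' : ℝ) - s| ^ p))| := by
  classical
  obtain ⟨w, hw0, hw1, hw⟩ := ax_repr hlam hp0 hp1 S x
  have hwlt : ∑ s, w s < 1 := by
    refine lt_of_le_of_ne hw1 fun hw1 => ?_
    let h : ℝ → ℝ := fun y => Real.exp (-(lam * |y - x| ^ p)) -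
      ∑ s : S, w s * Real.exp (-(lam * |y - s| ^ p))
    have hS : ∀ s : S, h s = 0 := by
      intro s
      simp only [h]
      rw [abs_sub_comm, ← hw s, sub_eq_zero]
      exact Finset.sum_congr rfl fun t _ => by rw [abs_sub_comm]
    have hxpos : 0 < h x := by
      simp only [h]
      have e : Real.exp (-(lam * |x - x| ^ p)) = ∑ s : S, w s * 1 := by
        simp only [mul_one, hw1]
        simp [Real.zero_rpow hp0.ne']
      rw [e, ← Finset.sum_sub_distrib]
      have hlt : ∀ s : S, Real.exp (-(lam * |x - s| ^ p)) < 1 := by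
        intro s
        rw [Real.exp_lt_one_iff]
        have : 0 < |x - s| := abs_pos.2 (sub_ne_zero.2 fun h => hx (h ▸ s.2))
        have : 0 < lam * |x - s| ^ p := by positivity
        linarith
      obtain ⟨s0, -, hs0⟩ : ∃ s ∈ (Finset.univ : Finset S), 0 < w s := by
        by_contra! hc
        have := Finset.sum_nonpos hc
        linarith
      refine Finset.sum_pos' (fun s _ => ?_) ⟨s0, Finset.mem_univ _, ?_⟩
      · nlinarith [hw0 s, hlt s]
      · nlinarith [hlt s0]
    have hnn : ∀ y, 0 ≤ h y := by
      intro y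
      have hW := ax_weak hlam hp0 hp1 (fun o : Option S => o.elim x (fun s => (s : ℝ)))
        (fun o : Option S => o.elim (-1) w) y
      have e : ∀ z, ∑ o : Option S, (o.elim (-1) w) *
          Real.exp (-(lam * |z - o.elim x (fun s => (s : ℝ))| ^ p)) = - h z := by
        intro z
        simp only [h, Fintype.sum_option, Option.elim]
        ring
      simp only [e] at hW
      rcases hW with hW | ⟨t, hW⟩
      · linarith
      · rcases t with _ | s
        · simp only [Option.elim] at hW; linarith
        · simp only [Option.elim] at hW; linarith [hS s]
    have hphi : ∀ z : ℝ, Continuous fun y : ℝ => Real.exp (-(lam * |y - z| ^ p)) := by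
      intro z
      have : Continuous fun y : ℝ => |y - z| ^ p :=
        Continuous.rpow_const (by fun_prop) fun _ => Or.inr hp0.le
      fun_prop
    have hcont : Continuous h :=
      (hphi x).sub (continuous_finsetSum _ fun s _ => continuous_const.mul (hphi s))
    have hI : ∀ z : ℝ, MeasureTheory.Integrable
        (fun y : ℝ => Real.exp (-(lam * |y - z| ^ p))) := fun z =>
      (ax_integrable hlam hp0).comp_sub_right z
    have hI2 : MeasureTheory.Integrable
        (fun y : ℝ => ∑ s : S, w s * Real.exp (-(lam * |y - s| ^ p))) :=
      MeasureTheory.integrable_finsetSum _ fun s _ => (hI s).const_mul _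
    have hint : MeasureTheory.Integrable h := (hI x).sub hI2
    have hzero : ∫ y, h y = 0 := by
      have et : ∀ z : ℝ, ∫ y : ℝ, Real.exp (-(lam * |y - z| ^ p)) =
          ∫ y : ℝ, Real.exp (-(lam * |y| ^ p)) := fun z =>
        MeasureTheory.integral_sub_right_eq_self (fun y : ℝ => Real.exp (-(lam * |y| ^ p))) z
      simp only [h]
      rw [MeasureTheory.integral_sub (hI x) hI2,
        MeasureTheory.integral_finsetSum _ fun (s : S) _ => (hI s).const_mul (w s)]
      simp only [MeasureTheory.integral_const_mul, et, ← Finset.sum_mul, hw1]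
      ring
    have := MeasureTheory.integral_pos_of_integrable_nonneg_nonzero hcont hint hnn hxpos.ne'
    linarith
  let g : ℝ → ℝ := fun y => ∑ s : S, a s * Real.exp (-(lam * |y - s| ^ p))
  change ∃ s' : S, |g x| < |g s'|
  change ∃ y, g y ≠ 0 at hne
  have hgx : g x = ∑ s : S, w s * g s := by
    simp only [g, ← hw, Finset.mul_sum]
    rw [Finset.sum_comm]
    exact Finset.sum_congr rfl fun t _ => Finset.sum_congr rfl fun s _ => by ring
  have hex : ∃ s : S, g s ≠ 0 := by
    by_contra! hz
    obtain ⟨y, hy⟩ := hne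
    have h1 := ax_weak hlam hp0 hp1 (fun s : S => (s : ℝ)) a y
    have h2 := ax_weak hlam hp0 hp1 (fun s : S => (s : ℝ)) (fun s => - a s) y
    simp only [neg_mul, Finset.sum_neg_distrib] at h2
    change g y ≤ 0 ∨ ∃ t : S, g y ≤ g t at h1
    change - g y ≤ 0 ∨ ∃ t : S, - g y ≤ - g t at h2
    simp only [hz] at h1 h2
    apply hy
    apply le_antisymm
    · rcases h1 with h | ⟨_, h⟩ <;> exact h
    · rcases h2 with h | ⟨_, h⟩ <;> linarith
  obtain ⟨s1, hs1⟩ := hex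
  obtain ⟨s0, -, hs0⟩ := Finset.exists_max_image Finset.univ (fun s : S => |g s|)
    ⟨s1, Finset.mem_univ _⟩
  have hpos : 0 < |g s0| := lt_of_lt_of_le (abs_pos.2 hs1) (hs0 s1 (Finset.mem_univ _))
  refine ⟨s0, ?_⟩
  calc |g x| ≤ ∑ s : S, |w s * g s| := by rw [hgx]; exact Finset.abs_sum_le_sum_abs _ _
    _ ≤ ∑ s : S, w s * |g s0| := by
        refine Finset.sum_le_sum fun s hs => ?_
        rw [abs_mul, abs_of_nonneg (hw0 s)]
        exact mul_le_mul_of_nonneg_left (hs0 s hs) (hw0 s)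
    _ = (∑ s, w s) * |g s0| := by rw [Finset.sum_mul]
    _ < |g s0| := by nlinarith

/-- every finite Cartesian grid is axis admissible with respect to a
Generalized Laplace kernel `κ(θ,θ') = exp(-λ‖θ-θ'‖_p^p)` with `λ > 0`, `0 < p ≤ 1`. -/
theorem laplace_grid_axis_admissible
    {D : ℕ} (hD : 1 ≤ D) (lam p : ℝ) (hlam : 0 < lam) (hp0 : 0 < p) (hp1 : p ≤ 1)
    (κ : (Fin D → ℝ) → (Fin D → ℝ) → ℝ)
    (hκ : ∀ θ θ' : Fin D → ℝ, κ θ θ' = Real.exp (-(lam * pPowSum p (θ - θ'))))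
    (Sd : Fin D → Finset ℝ) :
    AxisAdmissible Sd κ := by
  intro d θ hθ c
  obtain ⟨a, ha⟩ : ∃ a : Sd d → ℝ, ∀ t : ℝ,
      ∑ θ' ∈ Fintype.piFinset Sd, c θ' * κ (θ + t • (Pi.single d 1 : Fin D → ℝ)) θ' =
        ∑ s : Sd d, a s * Real.exp (-(lam * |t - s| ^ p)) := by
    refine ⟨fun s => ∑ θ' ∈ Fintype.piFinset Sd with θ' d = (s : ℝ),
      c θ' * Real.exp (-(lam * ∑ j ∈ Finset.univ.erase d, |θ j - θ' j| ^ p)), fun t => ?_⟩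
    rw [Finset.sum_coe_sort (Sd d) (fun s => (∑ θ' ∈ Fintype.piFinset Sd with θ' d = (s : ℝ),
      c θ' * Real.exp (-(lam * ∑ j ∈ Finset.univ.erase d, |θ j - θ' j| ^ p))) *
        Real.exp (-(lam * |t - s| ^ p)))]
    rw [← Finset.sum_fiberwise_of_maps_to (s := Fintype.piFinset Sd) (t := Sd d)
      (g := fun θ' => θ' d) (fun θ' h => Fintype.mem_piFinset.1 h d)]
    refine Finset.sum_congr rfl fun s _ => ?_
    rw [Finset.sum_mul]
    refine Finset.sum_congr rfl fun θ' h => ?_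
    have hs : θ' d = s := (Finset.mem_filter.1 h).2
    rw [hκ, pPowSum, ← Finset.add_sum_erase _ _ (Finset.mem_univ d), mul_assoc, ← Real.exp_add]
    have e1 : (θ + t • (Pi.single d 1 : Fin D → ℝ) - θ') d = t - s := by simp [hθ, hs]
    have e2 : ∑ j ∈ Finset.univ.erase d, |(θ + t • (Pi.single d 1 : Fin D → ℝ) - θ') j| ^ p =
        ∑ j ∈ Finset.univ.erase d, |θ j - θ' j| ^ p := by
      refine Finset.sum_congr rfl fun j hj => ?_
      simp [Finset.ne_of_mem_erase hj]
    rw [e1, e2]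
    ring_nf
  simp only [ha]
  intro hne
  have hne' : ∃ y : ℝ, ∑ s : Sd d, a s * Real.exp (-(lam * |y - s| ^ p)) ≠ 0 := by
    by_contra! h
    exact hne fun t => by rw [h t, abs_zero]
  have hstr := ax_strict hlam hp0 hp1 (Sd d) a
  have hnon : Nonempty (Sd d) := by
    by_contra hc
    rw [not_nonempty_iff] at hc
    obtain ⟨y, hy⟩ := hne'
    exact hy (by simp)
  obtain ⟨s0, -, hs0⟩ := Finset.exists_max_image Finset.univ
    (fun s' : Sd d => |∑ s : Sd d, a s * Real.exp (-(lam * |(s' : ℝ) - s| ^ p))|)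
    Finset.univ_nonempty
  refine ⟨⟨s0, fun y => ?_⟩, fun t ht => ?_⟩
  · by_cases hy : y ∈ Sd d
    · exact hs0 ⟨y, hy⟩ (Finset.mem_univ _)
    · obtain ⟨s', h⟩ := hstr y hy hne'
      exact h.le.trans (hs0 s' (Finset.mem_univ _))
  · by_contra hy
    obtain ⟨s', h⟩ := hstr t hy hne'
    exact absurd (ht s') (not_le.2 h)
end

section
/- Let κ be a CMF kernel in dimension D ≥ 1, i.e. κ(θ,θ') = φ(‖θ−θ'‖_p^p) with φ a CMF satisfying φ(0) = 1 and lim_{x→∞} φ(x) = 0 and 0 < p ≤ 1. Then for all θ₁, θ₂, θ₃ ∈ ℝ^D one has κ(θ₁,θ₂) · κ(θ₂,θ₃) ≤ κ(θ₁,θ₃). -/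
/-- A sequence of alternating-sign derivatives of a strictly completely monotone function. -/
def CMSeq (f : ℕ → ℝ → ℝ) : Prop :=
  (∀ n x, 0 < x → 0 < f n x) ∧
  (∀ n x, 0 < x → HasDerivAt (f n) (-(f (n + 1) x)) x) ∧
  Filter.Tendsto (f 0) Filter.atTop (nhds 0)

theorem anti_of_hasDerivAt {g g' : ℝ → ℝ} (h : ∀ x, 0 < x → HasDerivAt g (g' x) x)
    (h' : ∀ x, 0 < x → g' x ≤ 0) : AntitoneOn g (Set.Ioi 0) := by
  apply antitoneOn_of_deriv_nonpos (convex_Ioi 0)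
  · intro x hx
    exact (h x hx).continuousAt.continuousWithinAt
  · intro x hx
    rw [interior_Ioi] at hx
    exact (h x hx).differentiableAt.differentiableWithinAt
  · intro x hx
    rw [interior_Ioi] at hx
    rw [(h x hx).deriv]
    exact h' x hx

theorem nonneg_of_anti {g : ℝ → ℝ} (h : AntitoneOn g (Set.Ioi 0))
    (ht : Filter.Tendsto g Filter.atTop (nhds 0)) (x : ℝ) (hx : 0 < x) : 0 ≤ g x := by
  apply le_of_tendsto ht
  filter_upwards [Filter.eventually_ge_atTop x] with y hy
  exact h hx (lt_of_lt_of_le hx hy) hy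

theorem CMSeq.shift {f : ℕ → ℝ → ℝ} (hf : CMSeq f) : CMSeq (fun n => f (n + 1)) := by
  obtain ⟨hp, hd, ht⟩ := hf
  refine ⟨fun n => hp (n + 1), fun n => hd (n + 1), ?_⟩
  have hanti : AntitoneOn (f 1) (Set.Ioi 0) :=
    anti_of_hasDerivAt (hd 1) (fun x hx => by have := hp 2 x hx; simpa using this.le)
  have hb : ∀ x, 0 < x → f 1 (x + 1) ≤ f 0 x := by
    intro x hx
    obtain ⟨c, hc, hc'⟩ := exists_hasDerivAt_eq_slope (f 0) (fun x => -(f 1 x))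
      (show x < x + 1 by linarith)
      (fun y hy => (hd 0 y (by linarith [hy.1])).continuousAt.continuousWithinAt)
      (fun y hy => hd 0 y (by linarith [hy.1]))
    have h1 : f 1 (x + 1) ≤ f 1 c :=
      hanti (show 0 < c by linarith [hc.1]) (show 0 < x + 1 by linarith) hc.2.le
    have h2 := hp 0 (x + 1) (by linarith)
    simp at hc'
    linarith
  have : Filter.Tendsto (fun x => f 1 (x + 1)) Filter.atTop (nhds 0) := by
    apply tendsto_of_tendsto_of_tendsto_of_le_of_le' tendsto_const_nhds ht
    · filter_upwards [Filter.eventually_gt_atTop 0] with x hx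
      exact (hp 1 _ (by linarith)).le
    · filter_upwards [Filter.eventually_gt_atTop 0] with x hx
      exact hb x hx
  have h2 := this.comp (Filter.tendsto_atTop_add_const_right Filter.atTop (-1 : ℝ) Filter.tendsto_id)
  refine h2.congr ?_
  intro x
  simp

theorem CMSeq.two {f : ℕ → ℝ → ℝ} (hf : CMSeq f) (x : ℝ) (hx : 0 < x) :
    f 1 x ^ 2 ≤ 2 * f 0 x * f 2 x := by
  have t1 := hf.shift.2.2
  have t2 := hf.shift.shift.2.2
  obtain ⟨hp, hd, ht⟩ := hf
  have := nonneg_of_anti (g := fun x => 2 * f 0 x * f 2 x - f 1 x ^ 2)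
    (anti_of_hasDerivAt (g' := fun x => -(2 * f 0 x * f 3 x)) (fun x hx => by
      have := (((hd 0 x hx).const_mul 2).mul (hd 2 x hx)).sub ((hd 1 x hx).pow 2)
      exact this.congr_deriv (by norm_num)) (fun x hx => by
      have h0 := hp 0 x hx
      have h3 := hp 3 x hx
      have : 0 < 2 * f 0 x * f 3 x := by positivity
      linarith)) (by simpa using ((ht.const_mul 2).mul t2).sub (t1.pow 2)) x hx
  linarith

theorem CMSeq.step (k : ℕ) : ∀ {f : ℕ → ℝ → ℝ} (_ : CMSeq f) (x : ℝ) (_ : 0 < x),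
    k * f 1 x ^ 2 ≤ (k + 1) * (f 0 x * f 2 x) := by
  induction k with
  | zero =>
    intro f hf x hx
    have h0 := hf.1 0 x hx
    have h2 := hf.1 2 x hx
    simp
    positivity
  | succ k ih =>
    intro f hf x hx
    have hk := ih hf.shift
    have h2 := hf.two
    obtain ⟨hp, hd, ht⟩ := hf
    have hlim : Filter.Tendsto (fun x => f 1 x ^ 2 / f 2 x) Filter.atTop (nhds 0) := by
      apply tendsto_of_tendsto_of_tendsto_of_le_of_le' tendsto_const_nhds
        (show Filter.Tendsto (fun x => 2 * f 0 x) Filter.atTop (nhds 0) by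
          simpa using ht.const_mul 2)
      · filter_upwards [Filter.eventually_gt_atTop 0] with x hx
        have := hp 2 x hx
        positivity
      · filter_upwards [Filter.eventually_gt_atTop 0] with x hx
        rw [div_le_iff₀ (hp 2 x hx)]
        exact h2 x hx
    have key := nonneg_of_anti (g := fun x => (k + 2) * f 0 x - (k + 1) * (f 1 x ^ 2 / f 2 x))
      (anti_of_hasDerivAt
        (g' := fun x => (k + 2) * (-(f 1 x)) - (k + 1) *
          ((2 * f 1 x * (-(f 2 x)) * f 2 x - f 1 x ^ 2 * (-(f 3 x))) / f 2 x ^ 2))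
        (fun x hx => by
          have := ((hd 0 x hx).const_mul (k + 2 : ℝ)).sub
            ((((hd 1 x hx).pow 2).div (hd 2 x hx) (hp 2 x hx).ne').const_mul (k + 1 : ℝ))
          exact this.congr_deriv (by norm_num))
        (fun x hx => by
          have p1 := hp 1 x hx
          have p2 := hp 2 x hx
          have h := hk x hx
          simp only [zero_add, Nat.reduceAdd] at h
          have e : (k + 2 : ℝ) * (-(f 1 x)) - (k + 1) *
              ((2 * f 1 x * (-(f 2 x)) * f 2 x - f 1 x ^ 2 * (-(f 3 x))) / f 2 x ^ 2)
              = - (f 1 x * ((k + 1) * (f 1 x * f 3 x) - k * f 2 x ^ 2) / f 2 x ^ 2) := by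
            field_simp
            ring
          rw [e, neg_nonpos]
          apply div_nonneg _ (by positivity)
          apply mul_nonneg p1.le
          linarith))
      (by simpa using (ht.const_mul (k + 2 : ℝ)).sub (hlim.const_mul (k + 1 : ℝ))) x hx
    have p2 := hp 2 x hx
    have e : f 1 x ^ 2 / f 2 x * f 2 x = f 1 x ^ 2 := by field_simp
    have := mul_nonneg key p2.le
    push_cast
    nlinarith

theorem CMSeq.logconvex {f : ℕ → ℝ → ℝ} (hf : CMSeq f) (x : ℝ) (hx : 0 < x) :
    f 1 x ^ 2 ≤ f 0 x * f 2 x := by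
  by_contra! h
  obtain ⟨k, hk⟩ := exists_nat_gt (f 0 x * f 2 x / (f 1 x ^ 2 - f 0 x * f 2 x))
  rw [div_lt_iff₀ (by linarith)] at hk
  have := CMSeq.step k hf x hx
  nlinarith

theorem CMSeq.mul_le {f : ℕ → ℝ → ℝ} (hf : CMSeq f)
    (hc : ContinuousWithinAt (f 0) (Set.Ici 0) 0) (x y : ℝ) (hx : 0 < x) (hy : 0 < y) :
    f 0 x * f 0 y ≤ f 0 0 * f 0 (x + y) := by
  have hl := hf.logconvex
  obtain ⟨hp, hd, ht⟩ := hf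
  have hh : AntitoneOn (fun x => f 1 x / f 0 x) (Set.Ioi 0) :=
    anti_of_hasDerivAt
      (fun x hx => (hd 1 x hx).div (hd 0 x hx) (hp 0 x hx).ne') (fun x hx => by
        apply div_nonpos_of_nonpos_of_nonneg _ (by positivity)
        have := hl x hx
        simp only [zero_add, Nat.reduceAdd]
        nlinarith)
  have hG : AntitoneOn (fun s => -(f 0 (s + y) / f 0 s)) (Set.Ioi 0) :=
    anti_of_hasDerivAt
      (fun s hs => (((hd 0 (s + y) (by linarith)).comp_add_const s y).div (hd 0 s hs)
        (hp 0 s hs).ne').neg) (fun s hs => by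
        rw [neg_nonpos]
        apply div_nonneg _ (by positivity)
        have p0 := hp 0 s hs
        have p1 := hp 0 (s + y) (by linarith)
        have := hh hs (show 0 < s + y by linarith) (by linarith)
        simp only at this
        rw [div_le_div_iff₀ p1 p0] at this
        simp only [zero_add]
        nlinarith)
  have t0 : Filter.Tendsto (f 0) (nhdsWithin 0 (Set.Ioi 0)) (nhds (f 0 0)) :=
    hc.mono Set.Ioi_subset_Ici_self
  have ty : Filter.Tendsto (fun s => f 0 (s + y)) (nhdsWithin 0 (Set.Ioi 0)) (nhds (f 0 y)) := by
    have h1 : ContinuousAt (fun s => f 0 (s + y)) 0 := by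
      have := (hd 0 (0 + y) (by linarith)).comp_add_const 0 y
      exact this.continuousAt
    have := h1.tendsto
    rw [zero_add] at this
    exact this.mono_left nhdsWithin_le_nhds
  refine le_of_tendsto_of_tendsto (ty.const_mul (f 0 x)) (t0.mul_const (f 0 (x + y))) ?_
  filter_upwards [Ioc_mem_nhdsGT hx] with s hs
  have := hG hs.1 hx hs.2
  simp only [neg_le_neg_iff] at this
  rw [div_le_div_iff₀ (hp 0 s hs.1) (hp 0 x hx)] at this
  linarith

theorem IsCMF.mul_le {φ : ℝ → ℝ} (hφ : IsCMF φ)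
    (hφtop : Filter.Tendsto φ Filter.atTop (nhds 0)) (x y : ℝ) (hx : 0 < x) (hy : 0 < y) :
    φ x * φ y ≤ φ 0 * φ (x + y) := by
  obtain ⟨hs, hc, hn⟩ := hφ
  have key : ∀ ε : ℝ, 0 < ε → (φ x + ε * Real.exp (-x)) * (φ y + ε * Real.exp (-y)) ≤
      (φ 0 + ε * Real.exp (-0)) * (φ (x + y) + ε * Real.exp (-(x + y))) := by
    intro ε hε
    have hexp : ∀ z, HasDerivAt (fun z : ℝ => ε * Real.exp (-z)) (-(ε * Real.exp (-z))) z := by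
      intro z
      have := ((hasDerivAt_neg z).exp).const_mul ε
      exact this.congr_deriv (by ring)
    have hf : CMSeq (fun n z => (-1 : ℝ) ^ n * iteratedDeriv n φ z + ε * Real.exp (-z)) := by
      refine ⟨?_, ?_, ?_⟩
      · intro n z hz
        have := hn n z hz
        positivity
      · intro n z hz
        have hcd : ContDiffAt ℝ (⊤ : ℕ∞) φ z := hs.contDiffAt (Ioi_mem_nhds hz)
        have hdiff : DifferentiableAt ℝ (iteratedDeriv n φ) z := by
          rw [iteratedDeriv_eq_equiv_comp]
          exact (LinearIsometryEquiv.comp_differentiableAt_iff _).2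
            (hcd.differentiableAt_iteratedFDeriv (by exact_mod_cast WithTop.coe_lt_top n))
        have h1 := hdiff.hasDerivAt
        rw [← iteratedDeriv_succ] at h1
        have h2 := (h1.const_mul ((-1 : ℝ) ^ n)).add (hexp z)
        exact h2.congr_deriv (by ring)
      · have he : Filter.Tendsto (fun z : ℝ => ε * Real.exp (-z)) Filter.atTop (nhds 0) := by
          simpa using Real.tendsto_exp_neg_atTop_nhds_zero.const_mul ε
        simpa using hφtop.add he
    have := hf.mul_le (by
      simp only [pow_zero, one_mul, iteratedDeriv_zero]
      exact hc.add (hexp 0).continuousAt.continuousWithinAt) x y hx hy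
    simpa only [pow_zero, one_mul, iteratedDeriv_zero] using this
  have hcl : ∀ a b : ℝ, Filter.Tendsto (fun ε : ℝ => a + ε * b) (nhdsWithin 0 (Set.Ioi 0))
      (nhds a) := by
    intro a b
    have : ContinuousAt (fun ε : ℝ => a + ε * b) 0 := by fun_prop
    have := this.tendsto
    simp only [zero_mul, add_zero] at this
    exact this.mono_left nhdsWithin_le_nhds
  refine le_of_tendsto_of_tendsto ((hcl (φ x) (Real.exp (-x))).mul (hcl (φ y) (Real.exp (-y))))
    ((hcl (φ 0) (Real.exp (-0))).mul (hcl (φ (x + y)) (Real.exp (-(x + y))))) ?_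
  filter_upwards [self_mem_nhdsWithin] with ε hε
  exact key ε hε

theorem IsCMF.antitone {φ : ℝ → ℝ} (hφ : IsCMF φ) : AntitoneOn φ (Set.Ici 0) := by
  obtain ⟨hs, hc, hn⟩ := hφ
  have hd : ∀ z, 0 < z → DifferentiableAt ℝ φ z := fun z hz =>
    (hs.contDiffAt (Ioi_mem_nhds hz)).differentiableAt (by simp)
  apply antitoneOn_of_deriv_nonpos (convex_Ici 0)
  · intro z hz
    rcases eq_or_lt_of_le (show (0 : ℝ) ≤ z from hz) with h | h
    · rw [← h]
      exact hc
    · exact (hd z h).continuousAt.continuousWithinAt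
  · intro z hz
    rw [interior_Ici] at hz
    exact (hd z hz).differentiableWithinAt
  · intro z hz
    rw [interior_Ici] at hz
    have := hn 1 z hz
    simp at this
    exact this

theorem pPowSum_nonneg {D : ℕ} (p : ℝ) (x : Fin D → ℝ) : 0 ≤ pPowSum p x :=
  Finset.sum_nonneg fun d _ => Real.rpow_nonneg (abs_nonneg _) p

theorem pPowSum_add_le {D : ℕ} (p : ℝ) (hp0 : 0 < p) (hp1 : p ≤ 1) (x y : Fin D → ℝ) :
    pPowSum p (x + y) ≤ pPowSum p x + pPowSum p y := by
  unfold pPowSum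
  rw [← Finset.sum_add_distrib]
  apply Finset.sum_le_sum
  intro d _
  calc |(x + y) d| ^ p ≤ (|x d| + |y d|) ^ p :=
        Real.rpow_le_rpow (abs_nonneg _) (abs_add_le _ _) hp0.le
    _ ≤ _ := Real.rpow_add_le_add_rpow (abs_nonneg _) (abs_nonneg _) hp0.le hp1

/-- CMF kernels satisfy the multiplicative triangle-type inequality
`κ(θ₁,θ₂) κ(θ₂,θ₃) ≤ κ(θ₁,θ₃)`. -/
theorem cmf_kernel_mul_le
    {D : ℕ} (hD : 1 ≤ D) (φ : ℝ → ℝ) (hφ : IsCMF φ) (hφ0 : φ 0 = 1)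
    (hφtop : Filter.Tendsto φ Filter.atTop (nhds 0))
    (p : ℝ) (hp0 : 0 < p) (hp1 : p ≤ 1)
    (κ : (Fin D → ℝ) → (Fin D → ℝ) → ℝ)
    (hκ : ∀ θ θ' : Fin D → ℝ, κ θ θ' = φ (pPowSum p (θ - θ')))
    (θ₁ θ₂ θ₃ : Fin D → ℝ) :
    κ θ₁ θ₂ * κ θ₂ θ₃ ≤ κ θ₁ θ₃ := by
  rw [hκ, hκ, hκ]
  have hw := pPowSum_add_le p hp0 hp1 (θ₁ - θ₂) (θ₂ - θ₃)
  rw [sub_add_sub_cancel] at hw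
  have hu0 := pPowSum_nonneg p (θ₁ - θ₂)
  have hv0 := pPowSum_nonneg p (θ₂ - θ₃)
  have hw0 := pPowSum_nonneg p (θ₁ - θ₃)
  generalize pPowSum p (θ₁ - θ₂) = u at *
  generalize pPowSum p (θ₂ - θ₃) = v at *
  generalize pPowSum p (θ₁ - θ₃) = w at *
  have hanti : φ (u + v) ≤ φ w := hφ.antitone hw0 (add_nonneg hu0 hv0) hw
  refine le_trans ?_ hanti
  rcases eq_or_lt_of_le hu0 with hu | hu
  · subst hu
    simp [hφ0]
  rcases eq_or_lt_of_le hv0 with hv | hv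
  · subst hv
    simp [hφ0]
  have := hφ.mul_le hφtop u v hu hv
  rwa [hφ0, one_mul] at this
end
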